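/- For every μ ∈ (0,1) there exist a constant C ≥ 1 and a map T which, for every dimension d ≥ 1, takes as input a positive integer U, a finite tuple S of points of ℝ^d, a unit vector v ∈ ℝ^d, and ε, δ ∈ (0,1), and outputs `Accept` or `Reject` (with the acceptance event measurable in the sample), such that for all ε, δ ∈ (0,1) and all U ≥ (C·d/(ε·δ))^C: (Completeness) if S consists of M ≤ U i.i.d. samples from N(0,I_d), then with probability at least 1 − C·δ the sample S is such that T(U, S, v, ε, δ) = `Accept` simultaneously for every unit vector v ∈ ℝ^d; (Monotonicity under removal) if T(U, S, v, ε, δ) = `Accept` and S' is a sub-tuple of S (a tuple obtained from S by removing entries), then T(U, S', v, ε, δ) = `Accept`; (Soundness) for every finite tuple S with at most U entries and every unit vector v, if T(U, S, v, ε, δ) = `Accept` then for every unit vector v' ∈ ℝ^d one has (1/U)·#{x ∈ S : sign(v·x) ≠ sign(v'·x)} ≤ (1+μ)·∠(v,v')/π + C·ε, where entries of S are counted with multiplicity. -/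

import Mathlib

open MeasureTheory ProbabilityTheory Real
open scoped ENNReal

noncomputable section

/-- `sgn t = 1` if `t ≥ 0` and `-1` otherwise. -/
def sgn (t : ℝ) : ℝ := if 0 ≤ t then 1 else -1

/-- Euclidean dot product on `ℝ^d`. -/
def dotp {d : ℕ} (v w : Fin d → ℝ) : ℝ := ∑ i, v i * w i

/-- `v` is a unit vector. -/
def IsUnitVec {d : ℕ} (v : Fin d → ℝ) : Prop := dotp v v = 1

/-- The standard Gaussian measure `N(0, I_d)` on `ℝ^d`. -/
def stdGaussian (d : ℕ) : Measure (Fin d → ℝ) := Measure.pi fun _ => gaussianReal 0 1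

/-- The angle `∠(v, v') = arccos (v ⬝ v')` between unit vectors. -/
def angleOf {d : ℕ} (v w : Fin d → ℝ) : ℝ := Real.arccos (dotp v w)

/-- Number of entries of the tuple `S` satisfying `P` (with multiplicity). -/
def cnt {N : ℕ} {α : Type*} (S : Fin N → α) (P : α → Prop) : ℕ :=
  Nat.card {i : Fin N // P (S i)}

lemma inner_toLp {d : ℕ} (u x : Fin d → ℝ) :
    inner ℝ (WithLp.toLp 2 u : EuclideanSpace ℝ (Fin d)) (WithLp.toLp 2 x) = dotp u x := by
  simp [dotp, PiLp.inner_apply, mul_comm]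

lemma measurable_dotp {d : ℕ} (u : Fin d → ℝ) : Measurable (fun x => dotp u x) := by
  unfold dotp; fun_prop

instance {d : ℕ} : IsProbabilityMeasure (_root_.stdGaussian d) := by
  unfold _root_.stdGaussian; infer_instance

lemma map_dotp {d : ℕ} (u : Fin d → ℝ) (hu : IsUnitVec u) :
    (_root_.stdGaussian d).map (fun x => dotp u x) = gaussianReal 0 1 := by
  set P := ProbabilityTheory.stdGaussian (EuclideanSpace ℝ (Fin d)) with hP
  have h1 : (fun x => dotp u x) = (fun y => inner ℝ (WithLp.toLp 2 u : EuclideanSpace ℝ (Fin d)) y)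
      ∘ (WithLp.toLp 2) := by
    ext x; simp [inner_toLp]
  have h2 : (_root_.stdGaussian d).map (WithLp.toLp 2) = P := map_pi_eq_stdGaussian
  rw [h1, ← Measure.map_map (by fun_prop) (by fun_prop), h2]
  have h3 := IsGaussian.map_eq_gaussianReal (μ := P)
    (innerSL ℝ (WithLp.toLp 2 u : EuclideanSpace ℝ (Fin d)))
  rw [hP, integral_strongDual_stdGaussian, variance_dual_stdGaussian] at h3
  have h4 : ‖innerSL ℝ (WithLp.toLp 2 u : EuclideanSpace ℝ (Fin d))‖ ^ 2 = 1 := by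
    rw [innerSL_apply_norm, ← real_inner_self_eq_norm_sq, inner_toLp]; exact hu
  rw [h4] at h3
  simpa using h3

lemma map_dotp_pair {d : ℕ} (u w : Fin d → ℝ) (hu : IsUnitVec u) (hw : IsUnitVec w)
    (huw : dotp u w = 0) :
    (_root_.stdGaussian d).map (fun x => (dotp u x, dotp w x)) =
      (gaussianReal 0 1).prod (gaussianReal 0 1) := by
  have e : (gaussianReal 0 1).prod (gaussianReal 0 1) =
      ((_root_.stdGaussian d).map (fun x => dotp u x)).prod
        ((_root_.stdGaussian d).map (fun x => dotp w x)) := by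
    rw [map_dotp u hu, map_dotp w hw]
  rw [e]
  set P := ProbabilityTheory.stdGaussian (EuclideanSpace ℝ (Fin d)) with hP
  have h2 : (_root_.stdGaussian d).map (WithLp.toLp 2) = P := map_pi_eq_stdGaussian
  set X : EuclideanSpace ℝ (Fin d) → ℝ := fun y => inner ℝ (WithLp.toLp 2 u) y with hX
  set Y : EuclideanSpace ℝ (Fin d) → ℝ := fun y => inner ℝ (WithLp.toLp 2 w) y with hY
  have hXm : Measurable X := by fun_prop
  have hYm : Measurable Y := by fun_prop
  have h1 : ∀ v : Fin d → ℝ, (_root_.stdGaussian d).map (fun x => dotp v x) =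
      P.map (fun y => inner ℝ (WithLp.toLp 2 v : EuclideanSpace ℝ (Fin d)) y) := by
    intro v
    rw [← h2, Measure.map_map (by fun_prop) (by fun_prop)]
    congr 1; ext x; simp [inner_toLp]
  have h3 : (_root_.stdGaussian d).map (fun x => (dotp u x, dotp w x)) =
      P.map (fun y => (X y, Y y)) := by
    rw [← h2, Measure.map_map (by fun_prop) (by fun_prop)]
    congr 1; ext x <;> simp [hX, hY, inner_toLp]
  rw [h1, h1, h3]
  refine IndepFun.map_prod_eq_prod_map_map hXm.aemeasurable hYm.aemeasurable ?_
  apply HasGaussianLaw.indepFun_of_covariance_eq_zero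
  · have := (IsGaussian.hasGaussianLaw_id (μ := P)).map
      ((innerSL ℝ (WithLp.toLp 2 u : EuclideanSpace ℝ (Fin d))).prod
        (innerSL ℝ (WithLp.toLp 2 w : EuclideanSpace ℝ (Fin d))))
    exact this
  · rw [hX, hY, ← covarianceBilin_apply_eq_cov IsGaussian.memLp_two_id, hP,
      covarianceBilin_stdGaussian]
    rw [innerSL_apply_apply, inner_toLp, huw]

lemma gauss_band (τ : ℝ) : (gaussianReal 0 1) {t | |t| ≤ τ} ≤ ENNReal.ofReal τ := by
  rw [gaussianReal_apply _ one_ne_zero]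
  have : {t : ℝ | |t| ≤ τ} = Set.Icc (-τ) τ := by ext; simp [abs_le]
  rw [this]
  calc ∫⁻ x in Set.Icc (-τ) τ, gaussianPDF 0 1 x
      ≤ ∫⁻ x in Set.Icc (-τ) τ, ENNReal.ofReal (1/2) := by
        apply lintegral_mono
        intro x
        apply ENNReal.ofReal_le_ofReal
        rw [gaussianPDFReal]
        have h1 : rexp (-(x - 0) ^ 2 / (2 * ((1 : NNReal) : ℝ))) ≤ 1 := by
          rw [Real.exp_le_one_iff]
          apply div_nonpos_of_nonpos_of_nonneg <;> simp [sq_nonneg]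
        have h2 : (√(2 * π * ((1 : NNReal) : ℝ)))⁻¹ ≤ 1 / 2 := by
          rw [one_div]
          apply inv_anti₀ (by norm_num)
          apply Real.le_sqrt_of_sq_le
          have := Real.pi_gt_three
          norm_num; linarith
        have h3 : 0 ≤ (√(2 * π * ((1 : NNReal) : ℝ)))⁻¹ := by positivity
        have h4 := Real.exp_pos (-(x - 0) ^ 2 / (2 * ((1 : NNReal) : ℝ)))
        nlinarith
    _ = ENNReal.ofReal τ := by
        rw [setLIntegral_const, Real.volume_Icc, ← ENNReal.ofReal_mul (by norm_num)]
        congr 1; ring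

lemma gauss_tail {d : ℕ} (R : ℝ) (hR : 0 < R) :
    (_root_.stdGaussian d) {x | R ≤ dotp x x} ≤ ENNReal.ofReal (d / R) := by
  have h0 : ∫⁻ x, ENNReal.ofReal (dotp x x) ∂(_root_.stdGaussian d) = d := by
    have : ∀ x : Fin d → ℝ, ENNReal.ofReal (dotp x x) = ∑ i, ENNReal.ofReal ((x i) ^ 2) := by
      intro x
      rw [← ENNReal.ofReal_sum_of_nonneg (fun i _ => sq_nonneg _)]
      simp [dotp, sq]
    simp_rw [this]
    rw [lintegral_finsetSum _ (fun i _ => by fun_prop)]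
    have h1 : ∫⁻ t, ENNReal.ofReal (t ^ 2) ∂(gaussianReal 0 1) = 1 := by
      rw [← ofReal_integral_eq_lintegral_ofReal]
      · have := variance_fun_id_gaussianReal (μ := 0) (v := 1)
        rw [variance_of_integral_eq_zero (by fun_prop) (by simp)] at this
        simp at this
        simp [this]
      · exact (memLp_id_gaussianReal' 2 (by simp)).integrable_sq
      · exact Filter.Eventually.of_forall fun t => sq_nonneg t
    have h2 : ∀ i : Fin d, ∫⁻ x, ENNReal.ofReal ((x i) ^ 2) ∂(_root_.stdGaussian d) = 1 := by
      intro i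
      rw [← h1]
      exact (measurePreserving_eval (fun _ : Fin d => gaussianReal 0 1) i).lintegral_comp
        (f := fun t : ℝ => ENNReal.ofReal (t ^ 2)) (by fun_prop)
    simp [h2]
  have h1 := meas_ge_le_lintegral_div (μ := _root_.stdGaussian d)
    (f := fun x => ENNReal.ofReal (dotp x x)) (by unfold dotp; fun_prop)
    (ε := ENNReal.ofReal R) (by simpa using hR) (by simp)
  rw [h0] at h1
  rw [ENNReal.ofReal_div_of_pos hR, ENNReal.ofReal_natCast]
  refine le_trans (measure_mono ?_) h1
  intro x hx
  exact ENNReal.ofReal_le_ofReal hx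

lemma gauss_polar (A : Set (ℝ × ℝ)) (hA : MeasurableSet A) (Θ : Set ℝ) (hΘ : MeasurableSet Θ)
    (h : ∀ r : ℝ, 0 < r → ∀ φ : ℝ, ((r * cos φ, r * sin φ) ∈ A ↔ φ ∈ Θ)) :
    ((gaussianReal 0 1).prod (gaussianReal 0 1)) A =
      (∫⁻ r in Set.Ioi (0:ℝ), ENNReal.ofReal r * ENNReal.ofReal (rexp (-r ^ 2 / 2) / (2 * π))) *
        volume (Θ ∩ Set.Ioo (-π) π) := by
  rw [gaussianReal_of_var_ne_zero _ one_ne_zero,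
    prod_withDensity (by fun_prop) (by fun_prop), withDensity_apply _ hA,
    ← lintegral_indicator hA, ← Measure.volume_eq_prod, ← lintegral_comp_polarCoord_symm]
  have ht : polarCoord.target = Set.Ioi (0:ℝ) ×ˢ Set.Ioo (-π) π := rfl
  rw [ht, ← lintegral_indicator (measurableSet_Ioi.prod measurableSet_Ioo)]
  have hf : AEMeasurable (fun r : ℝ => (Set.Ioi (0:ℝ)).indicator (fun r =>
      ENNReal.ofReal r * ENNReal.ofReal (rexp (-r ^ 2 / 2) / (2 * π))) r) volume := by
    apply Measurable.aemeasurable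
    exact Measurable.indicator (by fun_prop) measurableSet_Ioi
  have hg : AEMeasurable (fun φ : ℝ => (Θ ∩ Set.Ioo (-π) π).indicator (1 : ℝ → ℝ≥0∞) φ) volume := by
    apply Measurable.aemeasurable
    exact Measurable.indicator measurable_one (hΘ.inter measurableSet_Ioo)
  rw [← lintegral_indicator measurableSet_Ioi,
    ← lintegral_indicator_one (hΘ.inter measurableSet_Ioo), ← lintegral_prod_mul hf hg,
    ← Measure.volume_eq_prod]
  congr 1
  ext ⟨r, φ⟩
  by_cases hr : 0 < r
  · by_cases hφ : φ ∈ Set.Ioo (-π) π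
    · have hmem : ((r, φ) : ℝ × ℝ) ∈ Set.Ioi (0:ℝ) ×ˢ Set.Ioo (-π) π := ⟨hr, hφ⟩
      rw [Set.indicator_of_mem hmem, Set.indicator_of_mem (show r ∈ Set.Ioi (0:ℝ) from hr)]
      have hsymm : polarCoord.symm (r, φ) = (r * cos φ, r * sin φ) := rfl
      rw [hsymm]
      by_cases hth : φ ∈ Θ
      · rw [Set.indicator_of_mem ((h r hr φ).2 hth), Set.indicator_of_mem (show φ ∈ Θ ∩ Set.Ioo (-π) π from ⟨hth, hφ⟩)]
        simp only [smul_eq_mul, Pi.one_apply, mul_one]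
        congr 1
        rw [gaussianPDF, gaussianPDF, ← ENNReal.ofReal_mul (gaussianPDFReal_nonneg _ _ _)]
        congr 1
        simp only [gaussianPDFReal, NNReal.coe_one, mul_one, sub_zero]
        rw [mul_mul_mul_comm, ← mul_inv, ← Real.exp_add, Real.mul_self_sqrt (by positivity),
          div_eq_inv_mul (rexp _)]
        congr 2
        have := Real.sin_sq_add_cos_sq φ
        linear_combination (-r ^ 2 / 2) * this
      · rw [Set.indicator_of_notMem (fun hh => hth ((h r hr φ).1 hh)),
          Set.indicator_of_notMem (fun hh => hth hh.1)]
        simp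
    · rw [Set.indicator_of_notMem (s := Set.Ioi (0:ℝ) ×ˢ Set.Ioo (-π) π) (a := (r, φ))
        (fun hh => hφ hh.2), Set.indicator_of_notMem (s := Θ ∩ Set.Ioo (-π) π) (fun hh => hφ hh.2)]
      simp
  · rw [Set.indicator_of_notMem (s := Set.Ioi (0:ℝ) ×ˢ Set.Ioo (-π) π) (a := (r, φ))
      (fun hh => hr hh.1),
      Set.indicator_of_notMem (s := Set.Ioi (0:ℝ)) (fun hh => hr hh)]
    simp

lemma sgn_ne_iff (a b : ℝ) : sgn a ≠ sgn b ↔ (0 ≤ a ∧ b < 0) ∨ (a < 0 ∧ 0 ≤ b) := by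
  unfold sgn
  by_cases ha : 0 ≤ a <;> by_cases hb : 0 ≤ b <;> simp [ha, hb, not_le.1] <;> linarith

lemma wedge_volume (θ : ℝ) (h0 : 0 ≤ θ) (_h1 : θ ≤ π) :
    volume ({φ | sgn (cos φ) ≠ sgn (cos (φ - θ))} ∩ Set.Ioo (-π) π) ≤ ENNReal.ofReal (2 * θ) := by
  have hπ := Real.pi_pos
  have hsub : ({φ | sgn (cos φ) ≠ sgn (cos (φ - θ))} ∩ Set.Ioo (-π) π) ⊆
      (Set.Icc (-(π/2)) (θ - π/2) ∪ Set.Icc (π/2) (min (θ + π/2) π)) ∪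
        Set.Icc (-π) (θ - 3 * π / 2) := by
    rintro φ ⟨hφ, h2, h3⟩
    rw [Set.mem_ofPred_eq, sgn_ne_iff] at hφ
    have key : ∀ x : ℝ, -(π/2) < x → x < π/2 → 0 < cos x := fun x a b => cos_pos_of_mem_Ioo ⟨a, b⟩
    rcases hφ with ⟨ha, hb⟩ | ⟨ha, hb⟩
    · left; left
      have hφ1 : -(π/2) ≤ φ := by
        by_contra hh
        push Not at hh
        have := cos_neg_of_pi_div_two_lt_of_lt (x := -φ) (by linarith) (by linarith)
        rw [cos_neg] at this; linarith
      refine ⟨hφ1, ?_⟩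
      have hφ2 : φ ≤ π/2 := by
        by_contra hh
        push Not at hh
        have := cos_neg_of_pi_div_two_lt_of_lt (x := φ) (by linarith) (by linarith)
        linarith
      by_contra hh
      push Not at hh
      have := cos_nonneg_of_mem_Icc (x := φ - θ) ⟨by linarith, by linarith⟩
      linarith
    · rcases le_or_gt φ 0 with hs | hs
      · right
        refine ⟨h2.le, ?_⟩
        have hφ1 : φ < -(π/2) := by
          by_contra hh
          push Not at hh
          have := cos_nonneg_of_mem_Icc (x := φ) ⟨by linarith, by linarith⟩
          linarith
        by_contra hh
        push Not at hh
        have := cos_neg_of_pi_div_two_lt_of_lt (x := -(φ - θ)) (by linarith) (by linarith)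
        rw [cos_neg] at this; linarith
      · left; right
        have hφ1 : π/2 < φ := by
          by_contra hh
          push Not at hh
          have := cos_nonneg_of_mem_Icc (x := φ) ⟨by linarith, by linarith⟩
          linarith
        refine ⟨hφ1.le, le_min ?_ h3.le⟩
        by_contra hh
        push Not at hh
        have := cos_neg_of_pi_div_two_lt_of_lt (x := φ - θ) (by linarith) (by linarith)
        linarith
  refine (measure_mono hsub).trans ?_
  refine (measure_union_le _ _).trans ?_
  refine (add_le_add_left (measure_union_le _ _) _).trans ?_
  rw [Real.volume_Icc, Real.volume_Icc, Real.volume_Icc]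
  rcases le_total θ (π/2) with h | h
  · rw [min_eq_left (by linarith), ENNReal.ofReal_of_nonpos (p := θ - 3 * π / 2 - -π) (by linarith),
      add_zero, ← ENNReal.ofReal_add (by linarith) (by linarith)]
    exact ENNReal.ofReal_le_ofReal (by linarith)
  · rw [min_eq_right (by linarith), ← ENNReal.ofReal_add (by linarith) (by linarith),
      ← ENNReal.ofReal_add (by linarith) (by linarith)]
    exact ENNReal.ofReal_le_ofReal (by linarith)

lemma measurable_sgn : Measurable sgn :=
  Measurable.ite measurableSet_Ici measurable_const measurable_const

lemma sgn_mul_pos (r t : ℝ) (hr : 0 < r) : sgn (r * t) = sgn t := by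
  unfold sgn
  simp [mul_nonneg_iff_of_pos_left hr]

lemma gauss_wedge (θ : ℝ) (h0 : 0 ≤ θ) (h1 : θ ≤ π) :
    ((gaussianReal 0 1).prod (gaussianReal 0 1))
      {p | sgn p.1 ≠ sgn (cos θ * p.1 + sin θ * p.2)} ≤ ENNReal.ofReal (θ / π) := by
  have hπ := Real.pi_pos
  have hms := measurable_sgn
  have hA : MeasurableSet {p : ℝ × ℝ | sgn p.1 ≠ sgn (cos θ * p.1 + sin θ * p.2)} := by
    apply MeasurableSet.compl
    apply measurableSet_eq_fun (by fun_prop) (by fun_prop)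
  have hΘ : MeasurableSet {φ : ℝ | sgn (cos φ) ≠ sgn (cos (φ - θ))} := by
    apply MeasurableSet.compl
    apply measurableSet_eq_fun (by fun_prop) (by fun_prop)
  rw [gauss_polar _ hA {φ | sgn (cos φ) ≠ sgn (cos (φ - θ))} hΘ]
  · have hu := gauss_polar Set.univ MeasurableSet.univ Set.univ MeasurableSet.univ (by simp)
    rw [measure_univ, Set.univ_inter, Real.volume_Ioo] at hu
    calc _ ≤ (∫⁻ r in Set.Ioi (0:ℝ), ENNReal.ofReal r * ENNReal.ofReal (rexp (-r ^ 2 / 2) / (2 * π)))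
          * ENNReal.ofReal (2 * θ) := by gcongr; exact wedge_volume θ h0 h1
      _ = (∫⁻ r in Set.Ioi (0:ℝ), ENNReal.ofReal r * ENNReal.ofReal (rexp (-r ^ 2 / 2) / (2 * π)))
          * ENNReal.ofReal (π - -π) * ENNReal.ofReal (θ / π) := by
          rw [mul_assoc, ← ENNReal.ofReal_mul (by linarith)]
          congr 2
          field_simp; ring
      _ = _ := by rw [← hu, one_mul]
  · intro r hr φ
    simp only [Set.mem_ofPred_eq]
    rw [show cos θ * (r * cos φ) + sin θ * (r * sin φ) = r * cos (φ - θ) by rw [cos_sub]; ring,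
      sgn_mul_pos _ _ hr, sgn_mul_pos _ _ hr]

lemma dotp_comm {d : ℕ} (u w : Fin d → ℝ) : dotp u w = dotp w u := by
  simp [dotp, mul_comm]

lemma dotp_add_left {d : ℕ} (u w x : Fin d → ℝ) : dotp (u + w) x = dotp u x + dotp w x := by
  simp [dotp, add_mul, Finset.sum_add_distrib]

lemma dotp_sub_left {d : ℕ} (u w x : Fin d → ℝ) : dotp (u - w) x = dotp u x - dotp w x := by
  simp [dotp, sub_mul, Finset.sum_sub_distrib]

lemma dotp_smul_left {d : ℕ} (a : ℝ) (u x : Fin d → ℝ) : dotp (a • u) x = a * dotp u x := by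
  simp [dotp, mul_assoc, Finset.mul_sum]

lemma dotp_sub_right {d : ℕ} (u w x : Fin d → ℝ) : dotp x (u - w) = dotp x u - dotp x w := by
  rw [dotp_comm, dotp_sub_left, dotp_comm u, dotp_comm w]

lemma dotp_smul_right {d : ℕ} (a : ℝ) (u x : Fin d → ℝ) : dotp x (a • u) = a * dotp x u := by
  rw [dotp_comm, dotp_smul_left, dotp_comm]

lemma dotp_self_nonneg {d : ℕ} (u : Fin d → ℝ) : 0 ≤ dotp u u :=
  Finset.sum_nonneg fun i _ => mul_self_nonneg _

lemma dotp_self_eq_zero {d : ℕ} (u : Fin d → ℝ) (h : dotp u u = 0) : u = 0 := by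
  unfold dotp at h
  rw [Finset.sum_eq_zero_iff_of_nonneg (fun i _ => mul_self_nonneg _)] at h
  ext i
  simpa using h i (Finset.mem_univ i)

lemma dotp_cs {d : ℕ} (u x : Fin d → ℝ) : dotp u x ^ 2 ≤ dotp u u * dotp x x := by
  have := Finset.sum_mul_sq_le_sq_mul_sq Finset.univ u x
  simpa [dotp, sq] using this

lemma dotp_abs_le {d : ℕ} (u w : Fin d → ℝ) (hu : IsUnitVec u) (hw : IsUnitVec w) :
    -1 ≤ dotp u w ∧ dotp u w ≤ 1 := by
  have := dotp_cs u w
  rw [hu, hw] at this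
  constructor <;> nlinarith

lemma sub_self_unit {d : ℕ} (u w : Fin d → ℝ) (hu : IsUnitVec u) (hw : IsUnitVec w) :
    dotp (u - w) (u - w) = 2 - 2 * dotp u w := by
  rw [dotp_sub_left, dotp_sub_right, dotp_sub_right, hu, hw, dotp_comm w u]; ring

lemma gauss_disagree {d : ℕ} (u w : Fin d → ℝ) (hu : IsUnitVec u) (hw : IsUnitVec w) :
    (_root_.stdGaussian d) {x | sgn (dotp u x) ≠ sgn (dotp w x)} ≤
      ENNReal.ofReal (angleOf u w / π) := by
  have hπ := Real.pi_pos
  obtain ⟨hc1, hc2⟩ := dotp_abs_le u w hu hw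
  rcases eq_or_lt_of_le hc2 with h1 | h1
  · have : u - w = 0 := dotp_self_eq_zero _ (by rw [sub_self_unit u w hu hw, h1]; ring)
    rw [sub_eq_zero] at this
    subst this
    simp
  rcases eq_or_lt_of_le hc1 with h2 | h2
  · rw [angleOf, ← h2, Real.arccos_neg_one, div_self hπ.ne']
    simpa using prob_le_one
  have hcos : cos (angleOf u w) = dotp u w := Real.cos_arccos hc1 hc2
  have hs : 0 < sin (angleOf u w) := by
    rw [angleOf, Real.sin_arccos]
    apply Real.sqrt_pos.2
    nlinarith
  have hs2 := Real.sin_sq_add_cos_sq (angleOf u w)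
  set θ := angleOf u w with hθ
  set z : Fin d → ℝ := (sin θ)⁻¹ • (w - (cos θ) • u) with hz
  have hzu : dotp u z = 0 := by
    rw [hz, dotp_smul_right, dotp_sub_right, dotp_smul_right, hu, hcos]; ring
  have hzz : IsUnitVec z := by
    unfold IsUnitVec
    rw [hz, dotp_smul_right, dotp_smul_left, dotp_sub_left, dotp_sub_right, dotp_sub_right,
      dotp_smul_left, dotp_smul_left, dotp_smul_right, dotp_smul_right, hu, hw, dotp_comm w u,
      ← hcos]
    field_simp
    linarith
  have hwx : ∀ x, dotp w x = cos θ * dotp u x + sin θ * dotp z x := by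
    intro x
    rw [hz, dotp_smul_left, dotp_sub_left, dotp_smul_left]
    field_simp
    ring
  have hm := measurable_sgn
  have hA : MeasurableSet {p : ℝ × ℝ | sgn p.1 ≠ sgn (cos θ * p.1 + sin θ * p.2)} := by
    apply MeasurableSet.compl
    apply measurableSet_eq_fun (by fun_prop) (by fun_prop)
  have := gauss_wedge θ (Real.arccos_nonneg _) (Real.arccos_le_pi _)
  rw [← map_dotp_pair u z hu hzz hzu, Measure.map_apply
    ((measurable_dotp u).prodMk (measurable_dotp z)) hA] at this
  convert this using 3
  ext x
  simp [hwx]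

lemma angleOf_eq {d : ℕ} (u w : Fin d → ℝ) (hu : IsUnitVec u) (hw : IsUnitVec w) :
    angleOf u w = InnerProductGeometry.angle (WithLp.toLp 2 u : EuclideanSpace ℝ (Fin d))
      (WithLp.toLp 2 w) := by
  have h : ∀ v : Fin d → ℝ, IsUnitVec v → ‖(WithLp.toLp 2 v : EuclideanSpace ℝ (Fin d))‖ = 1 := by
    intro v hv
    have : ‖(WithLp.toLp 2 v : EuclideanSpace ℝ (Fin d))‖ ^ 2 = 1 := by
      rw [← real_inner_self_eq_norm_sq, inner_toLp]; exact hv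
    nlinarith [norm_nonneg (WithLp.toLp 2 v : EuclideanSpace ℝ (Fin d))]
  rw [InnerProductGeometry.angle, h u hu, h w hw, inner_toLp, angleOf]
  simp

lemma angleOf_triangle {d : ℕ} (u v w : Fin d → ℝ) (hu : IsUnitVec u) (hv : IsUnitVec v)
    (hw : IsUnitVec w) : angleOf u w ≤ angleOf u v + angleOf v w := by
  rw [angleOf_eq u w hu hw, angleOf_eq u v hu hv, angleOf_eq v w hv hw]
  exact InnerProductGeometry.angle_le_angle_add_angle _ _ _

lemma angleOf_chord {d : ℕ} (u w : Fin d → ℝ) (hu : IsUnitVec u) (hw : IsUnitVec w) (η : ℝ)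
    (hη : 0 ≤ η) (h : dotp (u - w) (u - w) ≤ η ^ 2) : angleOf u w / π ≤ η / 2 := by
  have hπ := Real.pi_pos
  obtain ⟨hc1, hc2⟩ := dotp_abs_le u w hu hw
  rw [sub_self_unit u w hu hw] at h
  have hcos : cos (angleOf u w) = dotp u w := Real.cos_arccos hc1 hc2
  have h0 : 0 ≤ angleOf u w := Real.arccos_nonneg _
  have h1 : angleOf u w ≤ π := Real.arccos_le_pi _
  set θ := angleOf u w
  have h2 : 2 / π * (θ / 2) ≤ sin (θ / 2) := Real.mul_le_sin (by linarith) (by linarith)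
  have h3 : cos θ = 1 - 2 * sin (θ / 2) ^ 2 := by
    have := Real.cos_sq_add_sin_sq (θ / 2)
    have h4 := Real.cos_two_mul (θ / 2)
    rw [show 2 * (θ / 2) = θ by ring] at h4
    rw [h4]; linarith
  have h5 : 2 / π * (θ / 2) = θ / π := by field_simp
  rw [h5] at h2
  refine h2.trans (abs_le_of_sq_le_sq' ?_ (by linarith)).2
  nlinarith

lemma cnt_eq_sum {N : ℕ} {α : Type*} (S : Fin N → α) (D : Set α) :
    (cnt S (fun x => x ∈ D) : ℝ) = ∑ i, D.indicator (fun _ => (1:ℝ)) (S i) := by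
  classical
  unfold cnt
  rw [Nat.card_eq_fintype_card, Fintype.card_subtype, Finset.card_filter]
  push_cast
  apply Finset.sum_congr rfl
  intro i _
  simp [Set.indicator_apply]

lemma cnt_mono {N : ℕ} {α : Type*} (S : Fin N → α) (P Q : α → Prop) (h : ∀ x, P x → Q x) :
    cnt S P ≤ cnt S Q :=
  Nat.card_le_card_of_injective (fun i => ⟨i.1, h _ i.2⟩ : {i // P (S i)} → {i // Q (S i)})
    (fun a b hab => Subtype.ext (by simpa using hab))

lemma cnt_comp_le {N M : ℕ} {α : Type*} (S : Fin N → α) (P : α → Prop) (ι : Fin M → Fin N)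
    (hι : StrictMono ι) : cnt (S ∘ ι) P ≤ cnt S P :=
  Nat.card_le_card_of_injective
    (fun i => ⟨ι i.1, i.2⟩ : {i // P ((S ∘ ι) i)} → {i // P (S i)})
    (fun a b hab => Subtype.ext (hι.injective (by simpa using hab)))

lemma measurable_cnt {N : ℕ} {α : Type*} [MeasurableSpace α] (D : Set α) (hD : MeasurableSet D) :
    Measurable (fun S : Fin N → α => (cnt S (fun x => x ∈ D) : ℝ)) := by
  simp_rw [cnt_eq_sum]
  apply Finset.measurable_sum
  intro i _
  exact (measurable_const.indicator hD).comp (measurable_pi_apply i)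

lemma hoeffding_cnt {α : Type*} [MeasurableSpace α] (P : Measure α) [IsProbabilityMeasure P]
    (D : Set α) (hD : MeasurableSet D) (M U : ℕ) (hMU : M ≤ U) (hU : 0 < U) (ε : ℝ) (hε : 0 < ε) :
    (Measure.pi fun _ : Fin M => P)
      {S | ¬ ((cnt S (fun x => x ∈ D) : ℝ) ≤ U * (P.real D + ε))} ≤
      ENNReal.ofReal (rexp (-(2 * U * ε ^ 2))) := by
  have hU' : (0:ℝ) < U := by exact_mod_cast hU
  have hMU' : (M:ℝ) ≤ U := by exact_mod_cast hMU
  have hp : 0 ≤ P.real D := measureReal_nonneg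
  rcases Nat.eq_zero_or_pos M with rfl | hM
  · have : {S : Fin 0 → α | ¬ ((cnt S (fun x => x ∈ D) : ℝ) ≤ U * (P.real D + ε))} = ∅ := by
      ext S
      simp only [Set.mem_ofPred_eq, Set.mem_empty_iff_false, iff_false, not_not]
      rw [cnt_eq_sum]
      simp only [Finset.univ_eq_empty, Finset.sum_empty]
      positivity
    rw [this]; simp
  have hM' : (0:ℝ) < M := by exact_mod_cast hM
  set Q := (Measure.pi fun _ : Fin M => P) with hQ
  have hfm : Measurable (D.indicator (fun _ => (1:ℝ))) := measurable_const.indicator hD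
  have hint : ∫ x, D.indicator (fun _ => (1:ℝ)) x ∂P = P.real D := by
    rw [integral_indicator_const _ hD]; simp
  let X : Fin M → (Fin M → α) → ℝ := fun i S => D.indicator (fun _ => (1:ℝ)) (S i) - P.real D
  have hind : iIndepFun X Q := by
    apply iIndepFun_pi (X := fun _ x => D.indicator (fun _ => (1:ℝ)) x - P.real D)
    intro i
    exact (hfm.sub_const _).aemeasurable
  have hsub : ∀ i ∈ (Finset.univ : Finset (Fin M)),
      HasSubgaussianMGF (X i) ((‖(1:ℝ) - 0‖₊ / 2) ^ 2) Q := by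
    intro i _
    have h1 := hasSubgaussianMGF_of_mem_Icc (μ := Q) (X := fun S => D.indicator (fun _ => (1:ℝ)) (S i))
      (a := 0) (b := 1) (hfm.comp (measurable_pi_apply i)).aemeasurable
      (Filter.Eventually.of_forall fun S => by
        by_cases h : S i ∈ D <;> simp [h])
    have h2 : ∫ S, D.indicator (fun _ => (1:ℝ)) (S i) ∂Q = P.real D := by
      rw [← hint]
      exact integral_comp_eval (μ := fun _ : Fin M => P) (i := i) hfm.aestronglyMeasurable
    rw [h2] at h1
    exact h1
  have hmain := HasSubgaussianMGF.measure_sum_ge_le_of_iIndepFun hind hsub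
    (ε := U * ε) (by positivity)
  have hle : {S : Fin M → α | ¬ ((cnt S (fun x => x ∈ D) : ℝ) ≤ U * (P.real D + ε))} ⊆
      {S | U * ε ≤ ∑ i, X i S} := by
    intro S hS
    simp only [Set.mem_ofPred_eq, not_le] at hS ⊢
    rw [cnt_eq_sum] at hS
    simp only [X, Finset.sum_sub_distrib, Finset.sum_const, Finset.card_univ, Fintype.card_fin,
      nsmul_eq_mul]
    nlinarith
  refine (measure_mono hle).trans ?_
  rw [← ofReal_measureReal]
  apply ENNReal.ofReal_le_ofReal
  refine hmain.trans ?_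
  apply Real.exp_le_exp.2
  simp only [sub_zero, nnnorm_one, Finset.sum_const, Finset.card_univ, Fintype.card_fin]
  push_cast
  rw [nsmul_eq_mul, neg_div, neg_le_neg_iff, le_div_iff₀ (by positivity)]
  have : 0 ≤ U * ε ^ 2 * ((U:ℝ) - M) := by
    apply mul_nonneg (by positivity) (by linarith)
  nlinarith

lemma union_cnt {α J : Type*} [Fintype J] [MeasurableSpace α] (P : Measure α)
    [IsProbabilityMeasure P]
    (D : J → Set α) (hD : ∀ j, MeasurableSet (D j)) (M U : ℕ) (hMU : M ≤ U) (hU : 0 < U) (ε : ℝ)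
    (hε : 0 < ε) (δ : ℝ) (hδ : Fintype.card J * rexp (-(2 * U * ε ^ 2)) ≤ δ) :
    ENNReal.ofReal (1 - δ) ≤ (Measure.pi fun _ : Fin M => P)
      {S | ∀ j, (cnt S (fun x => x ∈ D j) : ℝ) ≤ U * (P.real (D j) + ε)} := by
  set G := {S : Fin M → α | ∀ j, (cnt S (fun x => x ∈ D j) : ℝ) ≤ U * (P.real (D j) + ε)} with hG
  have hGm : MeasurableSet G := by
    rw [hG, Set.ofPred_forall]
    exact MeasurableSet.iInter fun j => measurableSet_le (measurable_cnt _ (hD j)) measurable_const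
  have hc : (Measure.pi fun _ : Fin M => P) Gᶜ ≤ ENNReal.ofReal δ := by
    have : Gᶜ = ⋃ j, {S | ¬ ((cnt S (fun x => x ∈ D j) : ℝ) ≤ U * (P.real (D j) + ε))} := by
      ext S; simp [hG]
    rw [this]
    refine (measure_iUnion_fintype_le _ _).trans ?_
    refine (Finset.sum_le_sum fun j _ => hoeffding_cnt P (D j) (hD j) M U hMU hU ε hε).trans ?_
    rw [Finset.sum_const, Finset.card_univ, nsmul_eq_mul, ← ENNReal.ofReal_natCast,
      ← ENNReal.ofReal_mul (by positivity)]
    exact ENNReal.ofReal_le_ofReal hδ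
  have h1 := prob_compl_eq_one_sub (μ := Measure.pi fun _ : Fin M => P) hGm.compl
  rw [compl_compl] at h1
  have hδ0 : 0 ≤ δ := le_trans (by positivity) hδ
  rw [h1, ENNReal.ofReal_sub _ hδ0, ENNReal.ofReal_one]
  exact tsub_le_tsub_left hc _

/-- The grid cell of a vector. -/
def cell {d : ℕ} (m : ℕ) (v : Fin d → ℝ) : Fin d → Fin (2 * m + 1) :=
  fun i => ⟨min ⌊(v i + 1) * m⌋₊ (2 * m), by omega⟩

open Classical in
/-- A unit vector in a given grid cell, if there is one. -/
def rep {d : ℕ} (m : ℕ) (k : Fin d → Fin (2 * m + 1)) : Fin d → ℝ :=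
  if h : ∃ v : Fin d → ℝ, IsUnitVec v ∧ cell m v = k then Classical.choose h else 0

lemma rep_spec {d : ℕ} (m : ℕ) (v : Fin d → ℝ) (hv : IsUnitVec v) :
    IsUnitVec (rep m (cell m v)) ∧ cell m (rep m (cell m v)) = cell m v := by
  have h : ∃ w : Fin d → ℝ, IsUnitVec w ∧ cell m w = cell m v := ⟨v, hv, rfl⟩
  unfold rep
  rw [dif_pos h]
  exact Classical.choose_spec h

lemma coord_bound {d : ℕ} (v : Fin d → ℝ) (hv : IsUnitVec v) (i : Fin d) : -1 ≤ v i ∧ v i ≤ 1 := by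
  have h : v i * v i ≤ dotp v v :=
    Finset.single_le_sum (f := fun i => v i * v i) (fun i _ => mul_self_nonneg _) (Finset.mem_univ i)
  rw [hv] at h
  constructor <;> nlinarith

lemma cell_close {d : ℕ} (m : ℕ) (hm : 0 < m) (v w : Fin d → ℝ) (hv : IsUnitVec v)
    (hw : IsUnitVec w) (h : cell m v = cell m w) :
    dotp (v - w) (v - w) ≤ d / (m:ℝ) ^ 2 := by
  have hm' : (0:ℝ) < m := by exact_mod_cast hm
  have key : ∀ u : Fin d → ℝ, IsUnitVec u → ∀ i, (((cell m u i : Fin (2 * m + 1)) : ℕ) : ℝ) ≤ (u i + 1) * m ∧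
      (u i + 1) * m ≤ (((cell m u i : Fin (2 * m + 1)) : ℕ) : ℝ) + 1 := by
    intro u hu i
    obtain ⟨h1, h2⟩ := coord_bound u hu i
    have h3 : ⌊(u i + 1) * m⌋₊ ≤ 2 * m := by
      apply Nat.floor_le_of_le
      push_cast
      nlinarith
    have h4 : ((cell m u i : Fin (2 * m + 1)) : ℕ) = ⌊(u i + 1) * m⌋₊ := by
      simp [cell, h3]
    rw [h4]
    exact ⟨Nat.floor_le (mul_nonneg (by linarith) hm'.le), (Nat.lt_floor_add_one _).le⟩
  have hi : ∀ i, (v i - w i) * (v i - w i) ≤ 1 / (m:ℝ) ^ 2 := by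
    intro i
    obtain ⟨a1, a2⟩ := key v hv i
    obtain ⟨b1, b2⟩ := key w hw i
    rw [h] at a1 a2
    rw [le_div_iff₀ (by positivity)]
    have : ((v i - w i) * m) ^ 2 ≤ 1 := by
      rw [sq_le_one_iff_abs_le_one, abs_le]
      constructor <;> linarith
    nlinarith
  calc dotp (v - w) (v - w) ≤ ∑ _i : Fin d, 1 / (m:ℝ) ^ 2 := Finset.sum_le_sum fun i _ => hi i
    _ = d / (m:ℝ) ^ 2 := by simp [div_eq_mul_inv]

/-- The test set attached to a pair of grid cells. -/
def testSet {d : ℕ} (m : ℕ) (R τ : ℝ) (kl : (Fin d → Fin (2 * m + 1)) × (Fin d → Fin (2 * m + 1))) :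
    Set (Fin d → ℝ) :=
  {x | sgn (dotp (rep m kl.1) x) ≠ sgn (dotp (rep m kl.2) x)} ∪ {x | |dotp (rep m kl.1) x| ≤ τ} ∪
    {x | |dotp (rep m kl.2) x| ≤ τ} ∪ {x | R ≤ dotp x x}

lemma measurableSet_testSet {d : ℕ} (m : ℕ) (R τ : ℝ)
    (kl : (Fin d → Fin (2 * m + 1)) × (Fin d → Fin (2 * m + 1))) :
    MeasurableSet (testSet m R τ kl) := by
  have hm := measurable_sgn
  have h1 := measurable_dotp (rep m kl.1)
  have h2 := measurable_dotp (rep m kl.2)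
  refine ((MeasurableSet.union (MeasurableSet.compl ?_) ?_).union ?_).union ?_
  · exact measurableSet_eq_fun (by fun_prop) (by fun_prop)
  · exact measurableSet_le (by fun_prop) measurable_const
  · exact measurableSet_le (by fun_prop) measurable_const
  · exact measurableSet_le measurable_const (by unfold dotp; fun_prop)

lemma gauss_band_dotp {d : ℕ} (u : Fin d → ℝ) (hu : IsUnitVec u) (τ : ℝ) :
    (_root_.stdGaussian d) {x | |dotp u x| ≤ τ} ≤ ENNReal.ofReal τ := by
  have h := gauss_band τ
  rw [← map_dotp u hu, Measure.map_apply (measurable_dotp u)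
    (measurableSet_le (by fun_prop) measurable_const)] at h
  exact h

lemma testSet_prob {d : ℕ} (hd : 1 ≤ d) (m : ℕ) (ε : ℝ) (hε : 0 < ε)
    (kl : (Fin d → Fin (2 * m + 1)) × (Fin d → Fin (2 * m + 1)))
    (h1 : IsUnitVec (rep m kl.1)) (h2 : IsUnitVec (rep m kl.2)) :
    (_root_.stdGaussian d).real (testSet m (d / ε) ε kl) ≤
      angleOf (rep m kl.1) (rep m kl.2) / π + 3 * ε := by
  have hd' : (0:ℝ) < d := by exact_mod_cast hd
  have ha : 0 ≤ angleOf (rep m kl.1) (rep m kl.2) / π :=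
    div_nonneg (Real.arccos_nonneg _) Real.pi_pos.le
  apply ENNReal.toReal_le_of_le_ofReal (by positivity)
  unfold testSet
  refine (measure_union_le _ _).trans ?_
  refine (add_le_add ((measure_union_le _ _).trans (add_le_add ((measure_union_le _ _).trans
    (add_le_add (gauss_disagree _ _ h1 h2) (gauss_band_dotp _ h1 ε))) (gauss_band_dotp _ h2 ε)))
    (gauss_tail (d := d) (d / ε) (by positivity))).trans ?_
  rw [← ENNReal.ofReal_add ha hε.le, ← ENNReal.ofReal_add (by positivity) hε.le,
    ← ENNReal.ofReal_add (by positivity) (by positivity)]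
  apply ENNReal.ofReal_le_ofReal
  have : (d:ℝ) / (d / ε) = ε := by field_simp
  rw [this]; linarith

lemma sgn_eq_of_close (a b τ : ℝ) (h1 : τ < |b|) (h2 : |a - b| ≤ τ) : sgn a = sgn b := by
  by_contra hne
  obtain ⟨h3, h4⟩ := abs_le.1 h2
  rcases (sgn_ne_iff a b).1 hne with ⟨ha, hb⟩ | ⟨ha, hb⟩
  · rw [abs_of_neg hb] at h1; linarith
  · rw [abs_of_nonneg hb] at h1; linarith

/-- The grid resolution. -/
def res (d : ℕ) (ε : ℝ) : ℕ := ⌈(d:ℝ) / ε ^ 2⌉₊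

lemma res_pos {d : ℕ} (hd : 1 ≤ d) (ε : ℝ) (hε : 0 < ε) : 0 < res d ε := by
  have hd' : (0:ℝ) < d := by exact_mod_cast hd
  exact Nat.ceil_pos.2 (by positivity)

lemma res_close {d : ℕ} (hd : 1 ≤ d) (ε : ℝ) (hε : 0 < ε) :
    (d:ℝ) / (res d ε : ℝ) ^ 2 ≤ ε ^ 4 / d := by
  have hd' : (0:ℝ) < d := by exact_mod_cast hd
  have hm : (0:ℝ) < res d ε := by exact_mod_cast res_pos hd ε hε
  have h : (d:ℝ) / ε ^ 2 ≤ res d ε := Nat.le_ceil _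
  rw [div_le_iff₀ (by positivity)] at h
  rw [div_le_div_iff₀ (by positivity) hd']
  nlinarith [pow_le_pow_left₀ hd'.le h 2]

lemma rep_dist {d : ℕ} (hd : 1 ≤ d) (ε : ℝ) (hε : 0 < ε) (v : Fin d → ℝ) (hv : IsUnitVec v) :
    dotp (v - rep (res d ε) (cell (res d ε) v)) (v - rep (res d ε) (cell (res d ε) v)) ≤ ε ^ 4 / d := by
  obtain ⟨h1, h2⟩ := rep_spec (res d ε) v hv
  exact (cell_close _ (res_pos hd ε hε) _ _ hv h1 h2.symm).trans (res_close hd ε hε)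

lemma rep_sgn {d : ℕ} (hd : 1 ≤ d) (ε : ℝ) (hε : ε ∈ Set.Ioo (0:ℝ) 1) (v : Fin d → ℝ)
    (hv : IsUnitVec v) (x : Fin d → ℝ) (hx : dotp x x < d / ε)
    (hb : ε < |dotp (rep (res d ε) (cell (res d ε) v)) x|) :
    sgn (dotp v x) = sgn (dotp (rep (res d ε) (cell (res d ε) v)) x) := by
  obtain ⟨h0, h1⟩ := hε
  have hd' : (0:ℝ) < d := by exact_mod_cast hd
  refine sgn_eq_of_close _ _ ε hb ?_
  rw [← dotp_sub_left]
  apply abs_le_of_sq_le_sq _ h0.le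
  refine (dotp_cs _ _).trans ?_
  calc _ ≤ ε ^ 4 / d * (d / ε) :=
        mul_le_mul (rep_dist hd ε h0 v hv) hx.le (dotp_self_nonneg _) (by positivity)
    _ = ε ^ 3 := by field_simp
    _ ≤ ε ^ 2 := by nlinarith [sq_nonneg ε]

lemma rep_angle {d : ℕ} (hd : 1 ≤ d) (ε : ℝ) (hε : ε ∈ Set.Ioo (0:ℝ) 1) (v : Fin d → ℝ)
    (hv : IsUnitVec v) :
    angleOf v (rep (res d ε) (cell (res d ε) v)) / π ≤ ε / 2 := by
  obtain ⟨h0, h1⟩ := hε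
  have hd' : (1:ℝ) ≤ d := by exact_mod_cast hd
  apply angleOf_chord _ _ hv (rep_spec _ v hv).1 ε h0.le
  refine (rep_dist hd ε h0 v hv).trans ?_
  rw [div_le_iff₀ (by linarith)]
  have : ε ^ 4 ≤ ε ^ 2 := pow_le_pow_of_le_one h0.le h1.le (by norm_num)
  nlinarith [sq_nonneg ε]

lemma param_bound (d : ℕ) (hd : 1 ≤ d) (ε δ : ℝ) (hε : ε ∈ Set.Ioo (0:ℝ) 1)
    (hδ : δ ∈ Set.Ioo (0:ℝ) 1) (U : ℕ) (hU : (10 * (d:ℝ) / (ε * δ)) ^ (10:ℝ) ≤ (U : ℝ)) :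
    (Fintype.card ((Fin d → Fin (2 * res d ε + 1)) × (Fin d → Fin (2 * res d ε + 1))) : ℝ) *
      rexp (-(2 * U * ε ^ 2)) ≤ δ := by
  obtain ⟨h0, h1⟩ := hε
  obtain ⟨g0, g1⟩ := hδ
  have hd' : (1:ℝ) ≤ d := by exact_mod_cast hd
  have hd0 : (0:ℝ) < d := by linarith
  have hε2 : ε ^ 2 ≤ 1 := pow_le_one₀ h0.le h1.le
  have hres : ((2 * res d ε + 1 : ℕ) : ℝ) ≤ 5 * d / ε ^ 2 := by
    have : (res d ε : ℝ) < d / ε ^ 2 + 1 := Nat.ceil_lt_add_one (by positivity)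
    have h3 : 1 ≤ d / ε ^ 2 := by rw [le_div_iff₀ (by positivity)]; linarith
    push_cast
    rw [mul_div_assoc]
    linarith
  have hA : ((2 * res d ε + 1 : ℕ) : ℝ) ≤ rexp (5 * d / ε ^ 2) :=
    hres.trans (by linarith [Real.add_one_le_exp (5 * d / ε ^ 2)])
  have hcard : (Fintype.card ((Fin d → Fin (2 * res d ε + 1)) × (Fin d → Fin (2 * res d ε + 1))) : ℝ)
      ≤ rexp (10 * d ^ 2 / ε ^ 2) := by
    rw [Fintype.card_prod, Fintype.card_fun, Fintype.card_fin, Fintype.card_fin]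
    push_cast at hA ⊢
    have h5 : (2 * (res d ε : ℝ) + 1) ^ d ≤ rexp (5 * d / ε ^ 2) ^ d :=
      pow_le_pow_left₀ (by positivity) hA d
    calc _ ≤ rexp (5 * d / ε ^ 2) ^ d * rexp (5 * d / ε ^ 2) ^ d := by gcongr
      _ = _ := by
        rw [← Real.exp_nat_mul, ← Real.exp_add]
        congr 1; ring
  have hδe : rexp (-(1 / δ)) ≤ δ := by
    rw [Real.exp_neg]
    apply inv_le_of_inv_le₀ g0
    rw [one_div]
    linarith [Real.add_one_le_exp (δ⁻¹)]
  refine le_trans ?_ hδe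
  calc _ ≤ rexp (10 * d ^ 2 / ε ^ 2) * rexp (-(2 * U * ε ^ 2)) := by gcongr
    _ = rexp (10 * d ^ 2 / ε ^ 2 + -(2 * U * ε ^ 2)) := (Real.exp_add _ _).symm
    _ ≤ _ := by
      apply Real.exp_le_exp.2
      have hX1 : 1 ≤ d / (ε * δ) := by
        rw [le_div_iff₀ (by positivity)]; nlinarith
      have hpow : (10 * (d:ℝ) / (ε * δ)) ^ (10:ℝ) = 10 ^ 10 * (d / (ε * δ)) ^ 10 := by
        rw [show (10:ℝ) = ((10:ℕ):ℝ) by norm_num, Real.rpow_natCast]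
        push_cast
        rw [mul_div_assoc, mul_pow]
      rw [hpow] at hU
      have h6 : (d / (ε * δ)) ^ 4 ≤ (d / (ε * δ)) ^ 10 := pow_le_pow_right₀ hX1 (by norm_num)
      have h7 : d ^ 2 / (ε ^ 4 * δ) ≤ (d / (ε * δ)) ^ 4 := by
        rw [div_pow, mul_pow]
        apply div_le_div₀ (by positivity) (pow_le_pow_right₀ hd' (by norm_num)) (by positivity)
        have : δ ^ 4 ≤ δ := pow_le_of_le_one g0.le g1.le (by norm_num)
        gcongr
      have h8 : 10 * (d ^ 2 / (ε ^ 4 * δ)) ≤ U := by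
        have : 0 ≤ d ^ 2 / (ε ^ 4 * δ) := by positivity
        nlinarith
      have h9 : 20 * (d ^ 2 / (ε ^ 2 * δ)) ≤ 2 * U * ε ^ 2 := by
        have : 20 * (d ^ 2 / (ε ^ 2 * δ)) = 2 * (10 * (d ^ 2 / (ε ^ 4 * δ))) * ε ^ 2 := by
          field_simp; norm_num
        rw [this]; gcongr
      have h10 : (d:ℝ) ^ 2 / ε ^ 2 ≤ d ^ 2 / (ε ^ 2 * δ) := by
        apply div_le_div_of_nonneg_left (by positivity) (by positivity)
        nlinarith [sq_nonneg ε]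
      have h11 : 1 / δ ≤ d ^ 2 / (ε ^ 2 * δ) := by
        apply div_le_div₀ (by positivity) (one_le_pow₀ hd') (by positivity)
        nlinarith
      have h12 : 0 ≤ d ^ 2 / (ε ^ 2 * δ) := by positivity
      rw [mul_div_assoc]
      linarith

/-- The spectral tester: for every `μ ∈ (0,1)` there are `C ≥ 1` and a tester `T`
(taking additionally a positive integer `U`, with measurable acceptance event) satisfying
completeness (for `M ≤ U` i.i.d. Gaussian samples and `U ≥ (C·d/(ε·δ))^C`, with probability
`≥ 1 - C·δ` it accepts simultaneously for all unit vectors), monotonicity under removal of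
entries, and soundness: acceptance for a tuple of size `≤ U` certifies
`(1/U)·#{x ∈ S : sgn(v·x) ≠ sgn(v'·x)} ≤ (1+μ)·∠(v,v')/π + C·ε` for all unit `v'`. -/
theorem spectral_tester (μ : ℝ) (hμ : μ ∈ Set.Ioo (0:ℝ) 1) :
    ∃ (C : ℝ)
      (T : (d : ℕ) → ℕ → (N : ℕ) → (Fin N → (Fin d → ℝ)) → (Fin d → ℝ) → ℝ → ℝ → Bool),
      1 ≤ C ∧
      ∀ d : ℕ, 1 ≤ d → ∀ (ε δ : ℝ), ε ∈ Set.Ioo (0:ℝ) 1 → δ ∈ Set.Ioo (0:ℝ) 1 →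
        -- the acceptance event is measurable in the sample
        (∀ (U N : ℕ) (v : Fin d → ℝ),
          MeasurableSet {S : Fin N → (Fin d → ℝ) | T d U N S v ε δ = true}) ∧
        ∀ U : ℕ, 0 < U → (C * (d:ℝ) / (ε * δ)) ^ C ≤ (U : ℝ) →
          -- completeness
          (∀ M : ℕ, M ≤ U →
            ENNReal.ofReal (1 - C * δ) ≤
              (Measure.pi fun _ : Fin M => stdGaussian d)
                {S | ∀ v : Fin d → ℝ, IsUnitVec v → T d U M S v ε δ = true}) ∧
          -- monotonicity under removal of entries
          (∀ (N M : ℕ) (S : Fin N → (Fin d → ℝ)) (ι : Fin M → Fin N), StrictMono ι →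
            ∀ v : Fin d → ℝ, T d U N S v ε δ = true → T d U M (S ∘ ι) v ε δ = true) ∧
          -- soundness
          (∀ (N : ℕ), N ≤ U → ∀ (S : Fin N → (Fin d → ℝ)) (v : Fin d → ℝ), IsUnitVec v →
            T d U N S v ε δ = true →
            ∀ v' : Fin d → ℝ, IsUnitVec v' →
              (cnt S (fun x => sgn (dotp v x) ≠ sgn (dotp v' x)) : ℝ) / (U : ℝ) ≤
                (1 + μ) * angleOf v v' / π + C * ε) := by
  classical
  refine ⟨10, fun d U N S _ ε _ => decide (∀ kl, (cnt S (fun x => x ∈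
    testSet (res d ε) (d / ε) ε kl) : ℝ) ≤
      U * ((_root_.stdGaussian d).real (testSet (res d ε) (d / ε) ε kl) + ε)), by norm_num, ?_⟩
  intro d hd ε δ hε hδ
  refine ⟨?_, ?_⟩
  · intro U N _
    simp only [decide_eq_true_eq]
    rw [Set.ofPred_forall]
    exact MeasurableSet.iInter fun kl =>
      measurableSet_le (measurable_cnt _ (measurableSet_testSet _ _ _ kl)) measurable_const
  intro U hU0 hU
  refine ⟨?_, ?_, ?_⟩
  · intro M hM
    have h := union_cnt (_root_.stdGaussian d) (fun kl => testSet (res d ε) (d / ε) ε kl)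
      (fun kl => measurableSet_testSet _ _ _ kl) M U hM hU0 ε hε.1 δ
      (param_bound d hd ε δ hε hδ U hU)
    refine (ENNReal.ofReal_le_ofReal (by linarith [hδ.1])).trans (h.trans (measure_mono ?_))
    intro S hS v _
    simpa using hS
  · intro N M S ι hι v h
    rw [decide_eq_true_eq] at h ⊢
    intro kl
    exact le_trans (by exact_mod_cast cnt_comp_le S _ ι hι) (h kl)
  · intro N hN S v hv h v' hv'
    rw [decide_eq_true_eq] at h
    have hU' : (0:ℝ) < U := by exact_mod_cast hU0
    have hπ := Real.pi_pos
    set m := res d ε with hm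
    have hr := (rep_spec m v hv).1
    have hr' := (rep_spec m v' hv').1
    have hk := h (cell m v, cell m v')
    have hp := testSet_prob hd m ε hε.1 (cell m v, cell m v') hr hr'
    have hsub : cnt S (fun x => sgn (dotp v x) ≠ sgn (dotp v' x)) ≤
        cnt S (fun x => x ∈ testSet m (d / ε) ε (cell m v, cell m v')) := by
      apply cnt_mono
      intro x hx
      by_contra hnot
      simp only [testSet, Set.mem_union, Set.mem_ofPred_eq, not_or, not_le, not_not, ne_eq] at hnot
      obtain ⟨⟨⟨q1, q2⟩, q3⟩, q4⟩ := hnot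
      apply hx
      rw [rep_sgn hd ε hε v hv x q4 q2, rep_sgn hd ε hε v' hv' x q4 q3]
      exact q1
    have hsub' : (cnt S (fun x => sgn (dotp v x) ≠ sgn (dotp v' x)) : ℝ) ≤
        cnt S (fun x => x ∈ testSet m (d / ε) ε (cell m v, cell m v')) := by exact_mod_cast hsub
    have ha := rep_angle hd ε hε v hv
    have ha' := rep_angle hd ε hε v' hv'
    have t1 := angleOf_triangle (rep m (cell m v)) v (rep m (cell m v')) hr hv hr'
    have t2 := angleOf_triangle v v' (rep m (cell m v')) hv hv' hr'
    have hcomm : angleOf (rep m (cell m v)) v = angleOf v (rep m (cell m v)) := by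
      rw [angleOf, angleOf, dotp_comm]
    have t3 : angleOf (rep m (cell m v)) (rep m (cell m v')) / π ≤ angleOf v v' / π + ε := by
      have : angleOf (rep m (cell m v)) (rep m (cell m v')) / π ≤
          (angleOf v (rep m (cell m v)) + (angleOf v v' + angleOf v' (rep m (cell m v')))) / π := by
        gcongr; linarith
      rw [add_div, add_div] at this
      linarith
    have hv0 : 0 ≤ angleOf v v' / π := div_nonneg (Real.arccos_nonneg _) hπ.le
    rw [div_le_iff₀ hU', mul_comm]
    refine (hsub'.trans hk).trans (mul_le_mul_of_nonneg_left ?_ hU'.le)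
    rw [mul_div_assoc]
    have hμ0 := hμ.1
    have := hε.1
    simp only at hp
    nlinarith [mul_nonneg hμ0.le hv0]

end
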